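/- arXiv:1402.4981 — 2 statements merged into one kernel-verified Lean document; each statement's English description precedes it below -/
import Mathlib

section
/- Let p be a prime, G a finite group, H a normal subgroup of G, S a Sylow p-subgroup of G, and T := S ∩ H. Define C_S(E) := {g ∈ S | g centralizes T, and for every subgroup P ≤ T and every h ∈ H with hPh⁻¹ ≤ T there exists x ∈ C_G(g) such that xpx⁻¹ = hph⁻¹ for all p ∈ P}. Then C_S(E) is a subgroup of S, and it is strongly closed in S with respect to G: for every a ∈ C_S(E) and every g ∈ G with gag⁻¹ ∈ S, one has gag⁻¹ ∈ C_S(E). -/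
/-- The centralizer `C_S(E)` in `S` of the fusion system `E = F_{S ⊓ H}(H)`: the set of
`g ∈ S` centralizing `T := S ⊓ H` such that every morphism of `E` (conjugation by some
`h ∈ H` mapping a subgroup `P ≤ T` into `T`) is realized by an element of `C_G(g)`. -/
def fusionCent {G : Type*} [Group G] (S H : Subgroup G) : Set G :=
  {g | g ∈ S ∧ g ∈ Subgroup.centralizer ((S ⊓ H : Subgroup G) : Set G) ∧
    ∀ P : Subgroup G, P ≤ S ⊓ H → ∀ h ∈ H, (∀ x ∈ P, h * x * h⁻¹ ∈ S ⊓ H) →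
      ∃ c ∈ Subgroup.centralizer ({g} : Set G), ∀ q ∈ P, c * q * c⁻¹ = h * q * h⁻¹}

section FusionCentralizer

variable {G : Type*} [Group G] {p : ℕ}

/-- The conjugate of a subgroup `V` by `g`. -/
abbrev Subgroup.conjBy (g : G) (V : Subgroup G) : Subgroup G :=
  V.map (MulAut.conj g).toMonoidHom

theorem Subgroup.conj_mem_conjBy (g : G) {V : Subgroup G} {v : G} (hv : v ∈ V) :
    g * v * g⁻¹ ∈ V.conjBy g :=
  ⟨v, hv, rfl⟩

theorem Subgroup.conjBy_le_iff {g : G} {V W : Subgroup G} :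
    V.conjBy g ≤ W ↔ ∀ v ∈ V, g * v * g⁻¹ ∈ W := by
  refine ⟨fun h v hv => h (Subgroup.conj_mem_conjBy g hv), ?_⟩
  rintro h _ ⟨v, hv, rfl⟩
  exact h v hv

theorem Subgroup.card_conjBy (g : G) (V : Subgroup G) :
    Nat.card (V.conjBy g) = Nat.card V :=
  Subgroup.card_map_of_injective (MulAut.conj g).injective

/-- Every `p`-subgroup `V` of `M` lies in a Sylow `p`-subgroup `U` of `M`. -/
theorem Subgroup.exists_le_sylow [Finite G] [Fact p.Prime] {M V : Subgroup G} (hVM : V ≤ M)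
    (hV : IsPGroup p V) :
    ∃ U : Subgroup G, V ≤ U ∧ U ≤ M ∧ IsPGroup p U ∧ ¬ p ∣ U.relIndex M ∧
      ∀ W ≤ M, IsPGroup p W → ∃ m ∈ M, W.conjBy m ≤ U := by
  obtain ⟨Q, hQ⟩ := (hV.comap_of_injective M.subtype M.subtype_injective).exists_le_sylow
  refine ⟨(Q : Subgroup M).map M.subtype, ?_, Subgroup.map_subtype_le _, Q.isPGroup'.map _, ?_, ?_⟩
  · intro v hv
    exact ⟨⟨v, hVM hv⟩, hQ hv, rfl⟩
  · have := Q.not_dvd_index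
    rwa [Subgroup.relIndex, Subgroup.subgroupOf,
      Subgroup.comap_map_eq_self_of_injective M.subtype_injective]
  · intro W hWM hW
    obtain ⟨Q', hQ'⟩ := (hW.comap_of_injective M.subtype M.subtype_injective).exists_le_sylow
    obtain ⟨m, rfl⟩ := MulAction.exists_smul_eq M Q' Q
    refine ⟨m, m.2, Subgroup.conjBy_le_iff.2 fun w hw => ?_⟩
    refine ⟨m * ⟨w, hWM hw⟩ * m⁻¹, ?_, rfl⟩
    exact Subgroup.conj_mem_conjBy m (V := (Q' : Subgroup M)) (hQ' hw)

/-- A subgroup containing a Sylow `p`-subgroup and all `p'`-elements of `M` contains `M`. -/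
theorem Subgroup.le_of_sylow_le_of_coprime [Finite G] [Fact p.Prime] {M U B : Subgroup G}
    (hU : ¬ p ∣ U.relIndex M) (hUB : U ≤ B)
    (hB : ∀ x ∈ M, (orderOf x).Coprime p → x ∈ B) : M ≤ B := by
  rw [← Subgroup.relIndex_eq_one]
  by_contra hne
  obtain ⟨q, hq, hqB⟩ := Nat.exists_prime_and_dvd hne
  have : Fact q.Prime := ⟨hq⟩
  by_cases hpq : q = p
  · subst hpq
    exact hU (hqB.trans (Subgroup.relIndex_dvd_of_le_left M hUB))
  · obtain ⟨Q, -, hQM, hQ, hQi, -⟩ :=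
      Subgroup.exists_le_sylow (p := q) (bot_le : (⊥ : Subgroup G) ≤ M) IsPGroup.of_bot
    refine hQi (hqB.trans (Subgroup.relIndex_dvd_of_le_left M fun x hx => hB x (hQM hx) ?_))
    obtain ⟨k, hk⟩ := IsPGroup.iff_orderOf.1 hQ ⟨x, hx⟩
    rw [Subgroup.orderOf_mk] at hk
    rw [hk]
    exact ((Nat.coprime_primes hq Fact.out).2 hpq).pow_left k


theorem IsPGroup.lt_normalizer_inf [Finite G] [Fact p.Prime] {P R : Subgroup G}
    (hR : IsPGroup p R) (hPR : P < R) : P < Subgroup.normalizer (P : Set G) ⊓ R := by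
  have := hR.isNilpotent
  have hlt := Group.normalizerCondition_of_isNilpotent (P.subgroupOf R)
    (lt_top_iff_ne_top.2 fun h => hPR.not_ge (Subgroup.subgroupOf_eq_top.1 h))
  rw [← Subgroup.subgroupOf_normalizer_eq hPR.le] at hlt
  refine lt_of_le_of_ne (le_inf Subgroup.le_normalizer hPR.le) fun h => hlt.ne ?_
  rw [← Subgroup.inf_subgroupOf_right (Subgroup.normalizer (P : Set G)), ← h]

/-- A `p`-subgroup of `H ⊔ S` is conjugate by an element of `H` to a subgroup of `S`. -/
theorem Sylow.exists_conjBy_le_of_le_sup [Finite G] [Fact p.Prime] (S : Sylow p G)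
    (H : Subgroup G) [H.Normal] {V : Subgroup G} (hV : IsPGroup p V) (hVS : V ≤ H ⊔ S) :
    ∃ k ∈ H, V.conjBy k ≤ S := by
  obtain ⟨U, hSU, -, hU, -, hconj⟩ :=
    Subgroup.exists_le_sylow (p := p) (le_sup_right : (S : Subgroup G) ≤ H ⊔ S) S.isPGroup'
  obtain rfl := S.is_maximal' hU hSU
  obtain ⟨m, hm, hmV⟩ := hconj V hVS hV
  rw [sup_comm] at hm
  obtain ⟨s, hs, k, hk, rfl⟩ := Subgroup.mem_sup_of_normal_right.1 hm
  refine ⟨k, hk, Subgroup.conjBy_le_iff.2 fun v hv => ?_⟩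
  have := S.mul_mem (S.mul_mem (S.inv_mem hs) (Subgroup.conjBy_le_iff.1 hmV v hv)) hs
  simpa [mul_assoc] using this

theorem pow_conj_eq_pow_mul {a n w : G} (h : n * a * n⁻¹ = w * a) (hc : Commute n w) (k : ℕ) :
    n ^ k * a * (n ^ k)⁻¹ = w ^ k * a := by
  induction k with
  | zero => simp
  | succ k ih =>
    calc n ^ (k + 1) * a * (n ^ (k + 1))⁻¹ = n * (n ^ k * a * (n ^ k)⁻¹) * n⁻¹ := by
          rw [pow_succ']; group
      _ = n * w ^ k * (a * n⁻¹) := by rw [ih]; group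
      _ = w ^ k * (n * a * n⁻¹) := by rw [(hc.pow_right k).eq]; group
      _ = w ^ (k + 1) * a := by rw [h, pow_succ]; group

theorem commute_of_conj_eq_mul_of_coprime {a n w : G} (h : n * a * n⁻¹ = w * a)
    (hc : Commute n w) (hn : (orderOf n).Coprime p) {k : ℕ} (hw : w ^ p ^ k = 1) :
    Commute n a := by
  have h1 : w ^ orderOf n = 1 := by
    have := pow_conj_eq_pow_mul h hc (orderOf n)
    simpa using this
  have h2 : w = 1 := by
    rw [← orderOf_eq_one_iff]
    exact Nat.eq_one_of_dvd_coprimes (hn.pow_right k) (orderOf_dvd_of_pow_eq_one h1)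
      (orderOf_dvd_of_pow_eq_one hw)
  rw [h2, one_mul, mul_inv_eq_iff_eq_mul] at h
  exact h

theorem commute_of_commute_conj_mul_inv {a n w c : G} (h : n * a * n⁻¹ = w * a)
    (hc : Commute c a) (hcw : c * w * c⁻¹ = n * w * n⁻¹) (hva : Commute (c * n * c⁻¹ * n⁻¹) a)
    (hvw : Commute (c * n * c⁻¹ * n⁻¹) w) : Commute n w := by
  have h1 : (c * n * c⁻¹ * n⁻¹) * (w * a) * (c * n * c⁻¹ * n⁻¹)⁻¹ = w * a := by
    rw [(hvw.mul_right hva).eq, mul_inv_cancel_right]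
  have h2 : n * w * n⁻¹ * a = w * a := by
    calc n * w * n⁻¹ * a = c * w * (c⁻¹ * a) := by rw [← hcw]; group
      _ = c * (w * a) * c⁻¹ := by rw [hc.inv_left.eq]; group
      _ = c * n * (a * c⁻¹) * c * n⁻¹ * c⁻¹ := by rw [← h]; group
      _ = c * n * c⁻¹ * n⁻¹ * (n * a * n⁻¹) * (c * n * c⁻¹ * n⁻¹)⁻¹ := by
        rw [← hc.inv_left.eq]; group
      _ = w * a := by rw [h, h1]
  exact mul_inv_eq_iff_eq_mul.1 (mul_right_cancel h2)

theorem mem_of_mem_sup_zpowers_of_coprime {H : Subgroup G} [H.Normal] {a x : G} {k : ℕ}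
    (ha : a ^ p ^ k = 1) (hx : x ∈ H ⊔ Subgroup.zpowers a) (hp : (orderOf x).Coprime p) :
    x ∈ H := by
  obtain ⟨y, hy, z, ⟨i, rfl⟩, rfl⟩ := Subgroup.mem_sup_of_normal_left.1 hx
  have hq : ((y * a ^ i : G) : G ⧸ H) = ((a ^ i : G) : G ⧸ H) := by
    rw [QuotientGroup.mk_mul, (QuotientGroup.eq_one_iff y).2 hy, one_mul]
  have h1 : orderOf ((y * a ^ i : G) : G ⧸ H) ∣ orderOf (y * a ^ i) :=
    orderOf_map_dvd (QuotientGroup.mk' H) _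
  have h2 : orderOf ((y * a ^ i : G) : G ⧸ H) ∣ p ^ k := by
    refine orderOf_dvd_of_pow_eq_one ?_
    rw [hq, ← QuotientGroup.mk_pow, ← zpow_natCast, zpow_comm, zpow_natCast, ha, one_zpow,
      QuotientGroup.mk_one]
  have h3 := Nat.eq_one_of_dvd_coprimes (hp.pow_right k) h1 h2
  exact (QuotientGroup.eq_one_iff _).1 (orderOf_eq_one_iff.1 h3)

theorem conj_mul_inv_mem_of_mem_sup_zpowers {H : Subgroup G} [H.Normal] {a x : G}
    (hx : x ∈ H ⊔ Subgroup.zpowers a) : x * a * x⁻¹ * a⁻¹ ∈ H := by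
  obtain ⟨y, hy, z, ⟨i, rfl⟩, rfl⟩ := Subgroup.mem_sup_of_normal_left.1 hx
  have := H.mul_mem hy (Subgroup.Normal.conj_mem ‹_› _ (H.inv_mem hy) a)
  convert this using 1
  group

/-- Elements of `S ⊓ (H ⊔ ⟨a⟩)` commute with `a` if `a ∈ S` centralizes `S ⊓ H`. -/
theorem commute_of_mem_inf_sup_zpowers {H S : Subgroup G} [H.Normal] {a x : G} (haS : a ∈ S)
    (haT : ∀ t ∈ S ⊓ H, Commute t a) (hxS : x ∈ S) (hx : x ∈ H ⊔ Subgroup.zpowers a) :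
    Commute x a := by
  obtain ⟨y, hy, z, ⟨i, rfl⟩, rfl⟩ := Subgroup.mem_sup_of_normal_left.1 hx
  have hyS : y ∈ S := (S.mul_mem_cancel_right (S.zpow_mem haS i)).1 hxS
  exact (haT y ⟨hyS, hy⟩).mul_left ((Commute.refl a).zpow_left i)

theorem fusionCent_commute {S H : Subgroup G} {a : G} (ha : a ∈ fusionCent S H) :
    ∀ t ∈ S ⊓ H, Commute t a :=
  fun t ht => Subgroup.mem_centralizer_iff.1 ha.2.1 t ht

/-- Let `a ∈ C_S(E)` lie in `P ≤ S ⊓ H⟨a⟩`. If `a` centralizes a Sylow `p`-subgroup of the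
normalizer of `P` in `H⟨a⟩`, then `a` centralizes that normalizer. -/
theorem normalizer_le_centralizer_of_sylow_le [Finite G] [Fact p.Prime] {S H : Subgroup G}
    [H.Normal] (hS : IsPGroup p S) {a : G} (ha : a ∈ fusionCent S H) {P U N : Subgroup G}
    (haP : a ∈ P) (hPS : P ≤ S)
    (hN : N = (H ⊔ Subgroup.zpowers a) ⊓ Subgroup.normalizer (P : Set G))
    (hPL : P ≤ H ⊔ Subgroup.zpowers a) (hUi : ¬ p ∣ U.relIndex N)
    (hconj : ∀ W ≤ N, IsPGroup p W → ∃ m ∈ N, W.conjBy m ≤ U)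
    (hU : U ≤ Subgroup.centralizer {a}) : N ≤ Subgroup.centralizer {a} := by
  have hNL : ∀ n ∈ N, n ∈ H ⊔ Subgroup.zpowers a := fun n hn => (hN.le hn).1
  have hNP : ∀ n ∈ N, ∀ x, x ∈ P ↔ n * x * n⁻¹ ∈ P := fun n hn =>
    Subgroup.mem_normalizer_iff.1 (hN.le hn).2
  have hcent : ∀ x, x ∈ Subgroup.centralizer {a} ↔ Commute x a := fun x =>
    Subgroup.mem_centralizer_singleton_iff
  have hH : ∀ x g : G, x ∈ H ↔ g * x * g⁻¹ ∈ H := fun x g =>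
    ⟨fun h => Subgroup.Normal.conj_mem ‹_› x h g, fun h => by
      simpa [mul_assoc] using Subgroup.Normal.conj_mem ‹_› _ h g⁻¹⟩
  have hNPH : ∀ n ∈ N, ∀ x, x ∈ P ⊓ H ↔ n * x * n⁻¹ ∈ P ⊓ H := fun n hn x =>
    and_congr (hNP n hn x) (hH x n)
  have hw : ∀ n ∈ N, n * a * n⁻¹ * a⁻¹ ∈ P ⊓ H := fun n hn =>
    ⟨P.mul_mem ((hNP n hn a).1 haP) (P.inv_mem haP),
      conj_mul_inv_mem_of_mem_sup_zpowers (hNL n hn)⟩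
  have hpow : ∀ x ∈ S, ∃ k, x ^ p ^ k = 1 := fun x hx => by
    obtain ⟨k, hk⟩ := hS ⟨x, hx⟩
    exact ⟨k, by simpa using congrArg Subtype.val hk⟩
  have hV : N ⊓ Subgroup.centralizer ((P ⊓ H : Subgroup G) : Set G) ≤
      Subgroup.centralizer {a} := by
    set V := N ⊓ Subgroup.centralizer ((P ⊓ H : Subgroup G) : Set G)
    have hVc : ∀ v ∈ V, ∀ x ∈ P ⊓ H, Commute x v := fun v hv x hx =>
      Subgroup.mem_centralizer_iff.1 hv.2 x hx
    obtain ⟨Q, -, hQV, hQ, hQi, -⟩ :=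
      Subgroup.exists_le_sylow (p := p) (bot_le : (⊥ : Subgroup G) ≤ V) IsPGroup.of_bot
    refine Subgroup.le_of_sylow_le_of_coprime hQi (fun v hv => ?_) fun v hv hvp => ?_
    · obtain ⟨m, hm, hmQ⟩ := hconj Q (hQV.trans inf_le_left) hQ
      have h1 : Commute (m * v * m⁻¹) a :=
        (hcent _).1 (hU (Subgroup.conjBy_le_iff.1 hmQ v hv))
      have h2 : Commute v (m⁻¹ * a * m) := by
        have := (Commute.conj_iff m⁻¹).2 h1
        simpa [mul_assoc] using this
      have h3 := hw m⁻¹ (N.inv_mem hm)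
      rw [inv_inv] at h3
      have h4 := (hVc v (hQV hv) _ h3).symm.inv_right.mul_right h2
      have h5 : (m⁻¹ * a * m * a⁻¹)⁻¹ * (m⁻¹ * a * m) = a := by group
      rw [h5] at h4
      exact (hcent v).2 h4
    · obtain ⟨k, hk⟩ := hpow _ (hPS (hw v hv.1).1)
      rw [hcent]
      exact commute_of_conj_eq_mul_of_coprime (by group) (hVc v hv _ (hw v hv.1)).symm hvp hk
  refine Subgroup.le_of_sylow_le_of_coprime hUi hU fun n hn hnp => ?_
  rw [hcent]
  obtain ⟨j, hj⟩ := hpow a ha.1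
  have hnH : n ∈ H := mem_of_mem_sup_zpowers_of_coprime hj (hNL n hn) hnp
  obtain ⟨c, hc, hcn⟩ := ha.2.2 (P ⊓ H) (inf_le_inf_right H hPS) n hnH fun x hx =>
    inf_le_inf_right H hPS ((hNPH n hn x).1 hx)
  rw [hcent] at hc
  have hcPH : ∀ x ∈ P ⊓ H, c * x * c⁻¹ ∈ P ⊓ H := fun x hx => by
    rw [hcn x hx]
    exact (hNPH n hn x).1 hx
  have hcPH' : ∀ x ∈ P ⊓ H, c⁻¹ * x * c ∈ P ⊓ H := fun x hx => by
    have h1 : n⁻¹ * x * n ∈ P ⊓ H := by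
      have := (hNPH n⁻¹ (N.inv_mem hn) x).1 hx
      rwa [inv_inv] at this
    have h2 : c * (n⁻¹ * x * n) * c⁻¹ = x := by
      rw [hcn _ h1]
      group
    rw [← h2]
    convert h1 using 1
    group
  have hdec : ∀ x ∈ P, ∃ y ∈ P ⊓ H, ∃ i : ℤ, x = y * a ^ i := fun x hx => by
    obtain ⟨y, hy, z, ⟨i, rfl⟩, rfl⟩ := Subgroup.mem_sup_of_normal_left.1 (hPL hx)
    exact ⟨y, ⟨(P.mul_mem_cancel_right (P.zpow_mem haP i)).1 hx, hy⟩, i, rfl⟩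
  have hcP : ∀ x ∈ P, c * x * c⁻¹ ∈ P := fun x hx => by
    obtain ⟨y, hy, i, rfl⟩ := hdec x hx
    have := P.mul_mem (hcPH y hy).1 (P.zpow_mem haP i)
    convert this using 1
    rw [mul_assoc, mul_assoc, mul_assoc, (hc.inv_left.zpow_right i).eq]
    group
  have hcP' : ∀ x ∈ P, c⁻¹ * x * c ∈ P := fun x hx => by
    obtain ⟨y, hy, i, rfl⟩ := hdec x hx
    have := P.mul_mem (hcPH' y hy).1 (P.zpow_mem haP i)
    convert this using 1
    rw [mul_assoc, mul_assoc, mul_assoc, (hc.zpow_right i).eq]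
    group
  have hcnorm : c ∈ Subgroup.normalizer (P : Set G) := by
    rw [Subgroup.mem_normalizer_iff]
    refine fun x => ⟨hcP x, fun hx => ?_⟩
    have := hcP' _ hx
    simpa [mul_assoc] using this
  have hnnorm := (hN.le hn).2
  have hvN : c * n * c⁻¹ * n⁻¹ ∈ N := by
    rw [hN]
    refine ⟨Subgroup.mem_sup_left (H.mul_mem ((hH n c).1 hnH) (H.inv_mem hnH)), ?_⟩
    exact Subgroup.mul_mem _ (Subgroup.mul_mem _ (Subgroup.mul_mem _ hcnorm hnnorm)
      (Subgroup.inv_mem _ hcnorm)) (Subgroup.inv_mem _ hnnorm)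
  have hvP : ∀ x ∈ P ⊓ H, Commute (c * n * c⁻¹ * n⁻¹) x := fun x hx => by
    have h1 : n⁻¹ * x * n ∈ P ⊓ H := by
      have := (hNPH n⁻¹ (N.inv_mem hn) x).1 hx
      rwa [inv_inv] at this
    have h2 : c⁻¹ * (n⁻¹ * x * n) * c ∈ P ⊓ H := hcPH' _ h1
    have h3 : n * (c⁻¹ * (n⁻¹ * x * n) * c) * n⁻¹ = n⁻¹ * x * n := by
      rw [← hcn _ h2]
      group
    have h4 : c * (n⁻¹ * x * n) * c⁻¹ = x := by
      rw [hcn _ h1]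
      group
    refine mul_inv_eq_iff_eq_mul.1 ?_
    calc c * n * c⁻¹ * n⁻¹ * x * (c * n * c⁻¹ * n⁻¹)⁻¹
        = c * (n * (c⁻¹ * (n⁻¹ * x * n) * c) * n⁻¹) * c⁻¹ := by group
      _ = x := by rw [h3, h4]
  have hva : Commute (c * n * c⁻¹ * n⁻¹) a := by
    refine (hcent _).1 (hV ⟨hvN, Subgroup.mem_centralizer_iff.2 fun x hx => ?_⟩)
    exact (hvP x hx).eq.symm
  have hwn := hw n hn
  obtain ⟨k, hk⟩ := hpow _ (hPS hwn.1)
  refine commute_of_conj_eq_mul_of_coprime (by group) ?_ hnp hk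
  exact commute_of_commute_conj_mul_inv (by group) hc (hcn _ hwn) hva (hvP _ hwn)

/-- An element of `C_S(E)` is the only element of `S` in its `H`-conjugacy class. -/
theorem Sylow.commute_of_mem_fusionCent_of_conj_mem [Finite G] [Fact p.Prime] (S : Sylow p G)
    {H : Subgroup G} [H.Normal] {a h : G} (ha : a ∈ fusionCent (S : Subgroup G) H)
    (hh : h ∈ H) (haS : h * a * h⁻¹ ∈ (S : Subgroup G)) : Commute h a := by
  set L := H ⊔ Subgroup.zpowers a
  set R := (S : Subgroup G) ⊓ L
  have haL : a ∈ L := Subgroup.mem_sup_right (Subgroup.mem_zpowers a)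
  have haR : a ∈ R := ⟨ha.1, haL⟩
  have hHL : H ≤ L := le_sup_left
  have hLS : L ≤ H ⊔ S := sup_le_sup_left (by simpa using ha.1) H
  have hRp : IsPGroup p R := S.isPGroup'.to_le inf_le_left
  have hRa : ∀ x ∈ R, Commute x a := fun x hx =>
    commute_of_mem_inf_sup_zpowers ha.1 (fusionCent_commute ha) hx.1 hx.2
  have hsylow : ∀ V ≤ L, IsPGroup p V → ∃ k ∈ L, V.conjBy k ≤ R := fun V hVL hV => by
    obtain ⟨k, hk, hkV⟩ := S.exists_conjBy_le_of_le_sup H hV (hVL.trans hLS)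
    refine ⟨k, hHL hk, le_inf hkV (Subgroup.conjBy_le_iff.2 fun v hv => ?_)⟩
    exact L.mul_mem (L.mul_mem (hHL hk) (hVL hv)) (L.inv_mem (hHL hk))
  have key : ∀ (d : ℕ) (P : Subgroup G), Nat.card R - Nat.card P = d → P ≤ R → a ∈ P →
      ∀ g ∈ L, P.conjBy g ≤ R → Commute g a := by
    intro d
    induction d using Nat.strong_induction_on with
    | _ d ih =>
    intro P hd hPR haP g hg hgP
    have step : ∀ P', P' ≤ R → a ∈ P' → Nat.card P < Nat.card P' →
        ∀ g ∈ L, P'.conjBy g ≤ R → Commute g a := fun P' hP' haP' hcard => by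
      have := Subgroup.card_le_of_le hP'
      exact ih _ (by omega) P' rfl hP' haP'
    set N := L ⊓ Subgroup.normalizer (P : Set G) with hN
    have hVN : Subgroup.normalizer (P : Set G) ⊓ R ≤ N :=
      le_inf (inf_le_right.trans inf_le_right) inf_le_left
    obtain ⟨U, hVU, hUN, hUp, hUi, hUconj⟩ :=
      Subgroup.exists_le_sylow hVN (hRp.to_le inf_le_right)
    have hNc : ∀ k ∈ L, U.conjBy k ≤ R → Commute k a → N ≤ Subgroup.centralizer {a} := by
      intro k hk hkU hka
      refine normalizer_le_centralizer_of_sylow_le S.isPGroup' ha haP (hPR.trans inf_le_left) hN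
        (hPR.trans inf_le_right) hUi hUconj fun u hu => ?_
      rw [Subgroup.mem_centralizer_singleton_iff]
      have h1 := hRa _ (Subgroup.conjBy_le_iff.1 hkU u hu)
      have h2 := (hka.inv_left.mul_left h1).mul_left hka
      have h3 : k⁻¹ * (k * u * k⁻¹) * k = u := by group
      rw [h3] at h2
      exact h2
    obtain ⟨k, hk, hkU⟩ := hsylow U (hUN.trans inf_le_left) hUp
    rcases hPR.eq_or_lt with rfl | hlt
    · have hRU : R ≤ U := le_trans (le_inf Subgroup.le_normalizer le_rfl) hVU
      have hUR : R = U := Subgroup.eq_of_le_of_card_ge hRU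
        (by rw [← Subgroup.card_conjBy k U]; exact Subgroup.card_le_of_le hkU)
      have hNa := hNc 1 L.one_mem (Subgroup.conjBy_le_iff.2 fun u hu => by simpa [hUR] using hu)
        (Commute.one_left a)
      refine Subgroup.mem_centralizer_singleton_iff.1 (hNa ⟨hg, ?_⟩)
      exact Subgroup.mem_normalizer_iff_map_conj_eq.2
        (Subgroup.eq_of_le_of_card_ge hgP (Subgroup.card_conjBy g R).ge)
    · have grow : ∀ P', P' < R → Nat.card P' = Nat.card P → ∀ g ∈ L,
          (Subgroup.normalizer (P' : Set G) ⊓ R).conjBy g ≤ R → Commute g a := by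
        intro P' hP' hcard
        refine step _ inf_le_right ⟨?_, haR⟩ ?_
        · refine Subgroup.mem_normalizer_iff.2 fun x => ⟨fun hx => ?_, fun hx => ?_⟩
          · rwa [← (hRa x (hP'.le hx)).eq, mul_inv_cancel_right]
          · have h1 : a⁻¹ * (a * x * a⁻¹) * a = a * x * a⁻¹ := by
              rw [mul_assoc, (hRa _ (hP'.le hx)).eq, inv_mul_cancel_left]
            have h2 : a⁻¹ * (a * x * a⁻¹) * a = x := by group
            rwa [← h1, h2] at hx
        · rw [← hcard]
          exact Set.Finite.card_lt_card (Set.toFinite _) (hRp.lt_normalizer_inf hP')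
      have hka : Commute k a := grow P hlt rfl k hk (le_trans (Subgroup.map_mono hVU) hkU)
      have hNa := hNc k hk hkU hka
      set Q := P.conjBy g
      have hQc : Nat.card Q = Nat.card P := Subgroup.card_conjBy g P
      have hQlt : Q < R := lt_of_le_of_ne hgP fun h => by
        rw [h] at hQc
        exact hlt.ne (Subgroup.eq_of_le_of_card_ge hPR hQc.le)
      set W := (Subgroup.normalizer (Q : Set G) ⊓ R).conjBy g⁻¹
      have hWN : W ≤ N := by
        refine Subgroup.conjBy_le_iff.2 fun v hv => ⟨?_, ?_⟩
        · exact L.mul_mem (L.mul_mem (L.inv_mem hg) hv.2.2) (L.inv_mem (L.inv_mem hg))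
        · have hQm : ∀ x, g * x * g⁻¹ ∈ Q ↔ x ∈ P := fun x =>
            Subgroup.mem_map_iff_mem (f := (MulAut.conj g).toMonoidHom) (MulAut.conj g).injective
          refine Subgroup.mem_normalizer_iff.2 fun x => ?_
          rw [← hQm, ← hQm, Subgroup.mem_normalizer_iff.1 hv.1]
          have : g * (g⁻¹ * v * g⁻¹⁻¹ * x * (g⁻¹ * v * g⁻¹⁻¹)⁻¹) * g⁻¹ =
            v * (g * x * g⁻¹) * v⁻¹ := by group
          rw [this]
      obtain ⟨n, hn, hnW⟩ := hUconj W hWN ((hRp.to_le inf_le_right).map _)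
      have hna : Commute n a := Subgroup.mem_centralizer_singleton_iff.1 (hNa hn)
      have h1 : Commute (k * n * g⁻¹) a := by
        refine grow Q hQlt hQc _ (L.mul_mem (L.mul_mem hk hn.1) (L.inv_mem hg)) ?_
        refine Subgroup.conjBy_le_iff.2 fun v hv => ?_
        have := Subgroup.conjBy_le_iff.1 hkU _ (Subgroup.conjBy_le_iff.1 hnW _
          (Subgroup.conj_mem_conjBy g⁻¹ hv))
        convert this using 1
        group
      have h2 : (k * n * g⁻¹)⁻¹ * (k * n) = g := by group
      rw [← h2]
      exact h1.inv_left.mul_left (hka.mul_left hna)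
  refine key _ (Subgroup.zpowers a) rfl (by simpa using haR) (Subgroup.mem_zpowers a) h (hHL hh) ?_
  refine Subgroup.conjBy_le_iff.2 ?_
  rintro _ ⟨i, rfl⟩
  have h1 : h * a * h⁻¹ ∈ R := ⟨haS, L.mul_mem (L.mul_mem (hHL hh) haL) (L.inv_mem (hHL hh))⟩
  simpa [conj_zpow] using R.zpow_mem h1 i

theorem inv_mem_fusionCent {S H : Subgroup G} {a : G} (ha : a ∈ fusionCent S H) :
    a⁻¹ ∈ fusionCent S H := by
  refine ⟨S.inv_mem ha.1, Subgroup.inv_mem _ ha.2.1, fun P hP h hh hhP => ?_⟩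
  obtain ⟨c, hc, hcP⟩ := ha.2.2 P hP h hh hhP
  refine ⟨c, Subgroup.mem_centralizer_singleton_iff.2 ?_, hcP⟩
  exact Commute.inv_right (Subgroup.mem_centralizer_singleton_iff.1 hc)

theorem one_mem_fusionCent (S H : Subgroup G) : 1 ∈ fusionCent S H :=
  ⟨S.one_mem, Subgroup.one_mem _, fun _ _ h _ _ =>
    ⟨h, Subgroup.mem_centralizer_singleton_iff.2 (by simp), fun _ _ => rfl⟩⟩

theorem Sylow.mul_mem_fusionCent [Finite G] [Fact p.Prime] (S : Sylow p G)
    {H : Subgroup G} [H.Normal] {a b : G} (ha : a ∈ fusionCent (S : Subgroup G) H)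
    (hb : b ∈ fusionCent (S : Subgroup G) H) : a * b ∈ fusionCent (S : Subgroup G) H := by
  refine ⟨S.mul_mem ha.1 hb.1, Subgroup.mul_mem _ ha.2.1 hb.2.1, fun P hP h hh hhP => ?_⟩
  set X := (S : Subgroup G) ⊓
    Subgroup.centralizer (((S : Subgroup G) ⊓ H : Subgroup G) : Set G)
  have hXc : ∀ x ∈ X, ∀ t ∈ (S : Subgroup G) ⊓ H, Commute t x := fun x hx t ht =>
    Subgroup.mem_centralizer_iff.1 hx.2 t ht
  have hXp : IsPGroup p X := S.isPGroup'.to_le inf_le_left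
  set M := (H ⊔ X) ⊓ Subgroup.centralizer (P : Set G)
  have hXM : X ≤ M := le_inf le_sup_right fun x hx =>
    Subgroup.mem_centralizer_iff.2 fun t ht => hXc x hx t (hP ht)
  obtain ⟨U, hXU, hUM, hUp, -, hUconj⟩ := Subgroup.exists_le_sylow hXM hXp
  have hXhM : X.conjBy h⁻¹ ≤ M := by
    refine Subgroup.conjBy_le_iff.2 fun x hx => ⟨?_, ?_⟩
    · have hhX : h⁻¹ ∈ H ⊔ X := Subgroup.mem_sup_left (H.inv_mem hh)
      exact Subgroup.mul_mem _ (Subgroup.mul_mem _ hhX (Subgroup.mem_sup_right hx))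
        (Subgroup.inv_mem _ hhX)
    · refine Subgroup.mem_centralizer_iff.2 fun t ht => ?_
      have := (Commute.conj_iff h⁻¹).2 (hXc x hx _ (hhP t ht))
      have h1 : h⁻¹ * (h * t * h⁻¹) * h⁻¹⁻¹ = t := by group
      rw [h1] at this
      exact this
  obtain ⟨m, hm, hmX⟩ := hUconj _ hXhM (hXp.map _)
  obtain ⟨k, hk, hkU⟩ := S.exists_conjBy_le_of_le_sup H hUp
    (hUM.trans (inf_le_left.trans (sup_le_sup_left inf_le_left H)))
  have hmHX := hm.1
  rw [sup_comm] at hmHX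
  obtain ⟨x, hx, n, hn, rfl⟩ := Subgroup.mem_sup_of_normal_right.1 hmHX
  have hnP : n ∈ Subgroup.centralizer (P : Set G) :=
    (Subgroup.mul_mem_cancel_left _ (hXM hx).2).1 hm.2
  have hcomm : ∀ g ∈ fusionCent (S : Subgroup G) H, Commute (h * n⁻¹) g := by
    intro g hg
    have hgX : g ∈ X := ⟨hg.1, hg.2.1⟩
    have h1 : Commute k g := S.commute_of_mem_fusionCent_of_conj_mem hg hk
      (Subgroup.conjBy_le_iff.1 hkU g (hXU hgX))
    have h2 : Commute (k * n * h⁻¹) g := by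
      refine S.commute_of_mem_fusionCent_of_conj_mem hg
        (H.mul_mem (H.mul_mem hk hn) (H.inv_mem hh)) ?_
      have h3 := Subgroup.conjBy_le_iff.1 hmX _ (Subgroup.conj_mem_conjBy h⁻¹ hgX)
      have h4 := Subgroup.conjBy_le_iff.1 hkU _
        (U.mul_mem (U.mul_mem (U.inv_mem (hXU hx)) h3) (hXU hx))
      convert h4 using 1
      group
    have h5 : (k * n * h⁻¹)⁻¹ * k = h * n⁻¹ := by group
    rw [← h5]
    exact h2.inv_left.mul_left h1
  refine ⟨h * n⁻¹, Subgroup.mem_centralizer_singleton_iff.2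
    ((hcomm a ha).mul_right (hcomm b hb)), fun q hq => ?_⟩
  have hnq : Commute q n := Subgroup.mem_centralizer_iff.1 hnP q hq
  calc h * n⁻¹ * q * (h * n⁻¹)⁻¹ = h * (n⁻¹ * (q * n)) * h⁻¹ := by group
    _ = h * q * h⁻¹ := by rw [hnq.eq, inv_mul_cancel_left]

/-- The set `C_S(E)` is closed under conjugation by elements of the normalizer of `S ⊓ H`, as
long as the conjugate stays in `S`. -/
theorem conj_mem_fusionCent_of_mem_normalizer {S H : Subgroup G} [H.Normal] {a n : G}
    (ha : a ∈ fusionCent S H)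
    (hn : n ∈ Subgroup.normalizer ((S ⊓ H : Subgroup G) : Set G)) (hS : n * a * n⁻¹ ∈ S) :
    n * a * n⁻¹ ∈ fusionCent S H := by
  have hT := Subgroup.mem_normalizer_iff''.1 hn
  refine ⟨hS, Subgroup.mem_centralizer_iff.2 fun t ht => ?_, fun P hP h hh hhP => ?_⟩
  · have := (Commute.conj_iff n).2 (fusionCent_commute ha _ ((hT t).1 ht))
    have h1 : n * (n⁻¹ * t * n) * n⁻¹ = t := by group
    rw [h1] at this
    exact this
  · have hmem : ∀ x ∈ P.conjBy n⁻¹, n * x * n⁻¹ ∈ P := by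
      rintro _ ⟨y, hy, rfl⟩
      simpa [mul_assoc] using hy
    obtain ⟨c, hc, hcP⟩ := ha.2.2 (P.conjBy n⁻¹)
      (Subgroup.conjBy_le_iff.2 fun x hx => by simpa using (hT x).1 (hP hx))
      (n⁻¹ * h * n) (by simpa using Subgroup.Normal.conj_mem ‹_› h hh n⁻¹) fun x hx => by
        have := (hT _).1 (hhP _ (hmem x hx))
        convert this using 1
        group
    refine ⟨n * c * n⁻¹, Subgroup.mem_centralizer_singleton_iff.2
      ((Commute.conj_iff n).2 (Subgroup.mem_centralizer_singleton_iff.1 hc)), fun q hq => ?_⟩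
    have h1 := hcP _ (Subgroup.conj_mem_conjBy n⁻¹ hq)
    calc n * c * n⁻¹ * q * (n * c * n⁻¹)⁻¹ = n * (c * (n⁻¹ * q * n⁻¹⁻¹) * c⁻¹) * n⁻¹ := by group
      _ = h * q * h⁻¹ := by rw [h1]; group

theorem Sylow.conj_mem_fusionCent [Finite G] [Fact p.Prime] (S : Sylow p G)
    {H : Subgroup G} [H.Normal] {a g : G} (ha : a ∈ fusionCent (S : Subgroup G) H)
    (hg : g * a * g⁻¹ ∈ (S : Subgroup G)) : g * a * g⁻¹ ∈ fusionCent (S : Subgroup G) H := by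
  set T := (S : Subgroup G) ⊓ H
  have hconjH : ∀ x ∈ H, ∀ y : G, y * x * y⁻¹ ∈ H := fun x hx y =>
    Subgroup.Normal.conj_mem ‹_› x hx y
  obtain ⟨k, hk, hkV⟩ := S.exists_conjBy_le_of_le_sup H
    (V := (T ⊔ Subgroup.zpowers a).conjBy g)
    ((S.isPGroup'.to_le (sup_le inf_le_left (by simpa using ha.1))).map _) (by
      rw [Subgroup.conjBy, Subgroup.map_sup]
      refine sup_le (Subgroup.conjBy_le_iff.2 fun t ht =>
        Subgroup.mem_sup_left (hconjH t ht.2 g)) (Subgroup.conjBy_le_iff.2 ?_)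
      rintro _ ⟨i, rfl⟩
      refine Subgroup.mem_sup_right ?_
      simpa [conj_zpow] using Subgroup.zpow_mem _ hg i)
  have hkg : ∀ x ∈ T ⊔ Subgroup.zpowers a, k * g * x * (k * g)⁻¹ ∈ (S : Subgroup G) :=
    fun x hx => by
      have := Subgroup.conjBy_le_iff.1 hkV _ (Subgroup.conj_mem_conjBy g hx)
      convert this using 1
      group
  have hTle : T.conjBy (k * g) ≤ T := Subgroup.conjBy_le_iff.2 fun t ht =>
    ⟨hkg t (Subgroup.mem_sup_left ht), hconjH t ht.2 _⟩
  have hnorm : k * g ∈ Subgroup.normalizer (T : Set G) :=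
    Subgroup.mem_normalizer_iff_map_conj_eq.2
      (Subgroup.eq_of_le_of_card_ge hTle (Subgroup.card_conjBy (k * g) T).ge)
  have ha' := conj_mem_fusionCent_of_mem_normalizer ha hnorm
    (hkg a (Subgroup.mem_sup_right (Subgroup.mem_zpowers a)))
  have hback : k⁻¹ * (k * g * a * (k * g)⁻¹) * k⁻¹⁻¹ = g * a * g⁻¹ := by group
  have hcomm := S.commute_of_mem_fusionCent_of_conj_mem ha' (H.inv_mem hk) (hback ▸ hg)
  rw [← hback, mul_inv_eq_iff_eq_mul.2 hcomm.eq]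
  exact ha'

end FusionCentralizer

/-- For a normal pair realized by `H ⊴ G` with Sylow pair `(S, T := S ∩ H)`, the set
`C_S(E)` is a subgroup of `S` and is strongly closed in `S` with respect to `G`. -/
theorem fusionCent_subgroup_strongly_closed (p : ℕ) [Fact p.Prime] (G : Type*) [Group G]
    [Finite G] (H : Subgroup G) [H.Normal] (S : Sylow p G) :
    (∃ K : Subgroup G, (K : Set G) = fusionCent (S : Subgroup G) H) ∧
      (∀ a ∈ fusionCent (S : Subgroup G) H, ∀ g : G,
        g * a * g⁻¹ ∈ (S : Subgroup G) → g * a * g⁻¹ ∈ fusionCent (S : Subgroup G) H) := by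
  exact ⟨⟨{ carrier := fusionCent (S : Subgroup G) H
            mul_mem' := fun ha hb => S.mul_mem_fusionCent ha hb
            one_mem' := one_mem_fusionCent _ _
            inv_mem' := fun ha => inv_mem_fusionCent ha }, rfl⟩,
    fun _ ha _ hg => S.conj_mem_fusionCent ha hg⟩
end

section
/- Let p be a prime, G a finite group, H a normal subgroup of G, S a Sylow p-subgroup of G, and T := S ∩ H. Define C_S(E) := {g ∈ S | g centralizes T, and for every subgroup P ≤ T and every h ∈ H with hPh⁻¹ ≤ T there exists x ∈ C_G(g) such that xpx⁻¹ = hph⁻¹ for all p ∈ P}. Then every morphism of the fusion system of H on T extends to one fixing C_S(E) pointwise: for every subgroup P ≤ T and every h ∈ H with hPh⁻¹ ≤ T, there exists x ∈ G such that xcx⁻¹ = c for all c ∈ C_S(E) and xpx⁻¹ = hph⁻¹ for all p ∈ P. In particular, C_S(E) is the largest subgroup X of S ∩ C_G(T) such that F_T(H) ⊆ C_{F_S(G)}(X). -/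
namespace Subgroup

variable {G : Type*} [Group G] {p : ℕ}

/-- `Y` is a Sylow `p`-subgroup of the subgroup `N`, expressed inside the ambient group. -/
structure IsSylowIn (p : ℕ) (Y N : Subgroup G) : Prop where
  le : Y ≤ N
  isPGroup : IsPGroup p Y
  eq_of_le : ∀ W : Subgroup G, W ≤ N → IsPGroup p W → Y ≤ W → W = Y

theorem mem_map_conj_iff {P : Subgroup G} {k x : G} :
    x ∈ P.map (MulAut.conj k).toMonoidHom ↔ k⁻¹ * x * k ∈ P := by
  constructor
  · rintro ⟨y, hy, rfl⟩
    simpa [mul_assoc] using hy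
  · intro hx
    exact ⟨_, hx, by simp [mul_assoc]⟩

theorem card_map_conj (P : Subgroup G) (k : G) :
    Nat.card (P.map (MulAut.conj k).toMonoidHom) = Nat.card P :=
  Nat.card_congr (P.equivMapOfInjective _ (MulAut.conj k).injective).symm.toEquiv

theorem exists_isSylowIn_ge {Z N : Subgroup G} (hZN : Z ≤ N) (hZ : IsPGroup p Z) :
    ∃ W, IsSylowIn p W N ∧ Z ≤ W := by
  obtain ⟨W, hW⟩ := (hZ.of_equiv (subgroupOfEquivOfLe hZN).symm).exists_le_sylow
  refine ⟨W.map N.subtype, ⟨map_subtype_le _, W.isPGroup'.map _, fun V hVN hV hWV => ?_⟩, ?_⟩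
  · have := W.is_maximal' (hV.of_equiv (subgroupOfEquivOfLe hVN).symm)
      (fun x hx => hWV ⟨x, hx, rfl⟩)
    rw [← this, subgroupOf_map_subtype, inf_eq_left.2 hVN]
  · intro z hz
    exact ⟨⟨z, hZN hz⟩, hW hz, rfl⟩

/-- The Sylow subgroup of `↥N` given by a Sylow subgroup of `N` in the ambient group. -/
def IsSylowIn.toSylow {Y N : Subgroup G} (h : IsSylowIn p Y N) : Sylow p N where
  toSubgroup := Y.subgroupOf N
  isPGroup' := h.isPGroup.of_equiv (subgroupOfEquivOfLe h.le).symm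
  is_maximal' {Q} hQ hYQ := by
    have := h.eq_of_le (Q.map N.subtype) (map_subtype_le _) (hQ.map _)
      (fun y hy => ⟨⟨y, h.le hy⟩, hYQ hy, rfl⟩)
    rw [← this]
    exact (comap_map_eq_self_of_injective N.subtype_injective Q).symm

theorem IsSylowIn.exists_conj_mem [Finite G] [Fact p.Prime] {Y N W : Subgroup G}
    (hY : IsSylowIn p Y N) (hWN : W ≤ N) (hW : IsPGroup p W) :
    ∃ n ∈ N, ∀ w ∈ W, n * w * n⁻¹ ∈ Y := by
  obtain ⟨V, hV⟩ := (hW.of_equiv (subgroupOfEquivOfLe hWN).symm).exists_le_sylow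
  obtain ⟨n, hn⟩ := MulAction.exists_smul_eq N V hY.toSylow
  refine ⟨n, n.2, fun w hw => ?_⟩
  have : n * (⟨w, hWN hw⟩ : N) * n⁻¹ ∈ n • V := ⟨_, hV hw, rfl⟩
  rw [hn] at this
  exact this

theorem eq_of_conj_mem [Finite G] {A B : Subgroup G} (hAB : A ≤ B) {n : G}
    (h : ∀ w ∈ B, n * w * n⁻¹ ∈ A) : B = A := by
  refine (eq_of_le_of_card_ge hAB ?_).symm
  rw [← card_map_conj B n]
  refine card_le_of_le ?_
  rintro _ ⟨b, hb, rfl⟩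
  exact h b hb

theorem IsSylowIn.inf [Finite G] [Fact p.Prime] {Y N K : Subgroup G}
    (hY : IsSylowIn p Y N) (hKN : K ≤ N) (hK : ∀ n ∈ N, ∀ k ∈ K, n * k * n⁻¹ ∈ K) :
    IsSylowIn p (Y ⊓ K) K := by
  refine ⟨inf_le_right, hY.isPGroup.to_le inf_le_left, fun W hWK hW hle => ?_⟩
  obtain ⟨n, hn, h⟩ := hY.exists_conj_mem (hWK.trans hKN) hW
  exact eq_of_conj_mem hle fun w hw => ⟨h w hw, hK n hn w (hWK hw)⟩

theorem le_of_forall_orderOf_coprime_mem [Finite G] [Fact p.Prime] {Y N M : Subgroup G}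
    (hY : IsSylowIn p Y N) (hYM : Y ≤ M) (h : ∀ n ∈ N, (orderOf n).Coprime p → n ∈ M) :
    N ≤ M := by
  rw [← relIndex_eq_one]
  refine Nat.eq_one_iff_not_exists_prime_dvd.2 fun q hq hdvd => ?_
  have : Fact q.Prime := ⟨hq⟩
  by_cases hqp : q = p
  · subst hqp
    exact hY.toSylow.not_dvd_index (hdvd.trans (index_dvd_of_le fun y hy => hYM hy))
  · let V : Sylow q N := default
    refine V.not_dvd_index (hdvd.trans (index_dvd_of_le fun y hy => h y y.2 ?_))
    obtain ⟨k, hk⟩ := (IsPGroup.iff_orderOf.1 V.isPGroup') ⟨y, hy⟩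
    rw [orderOf_coe, ← orderOf_mk y hy, hk]
    exact Nat.Coprime.pow_left _ ((Nat.coprime_primes hq Fact.out).2 hqp)

theorem _root_.IsPGroup.lt_inf_normalizer [Finite G] [Fact p.Prime] {P T : Subgroup G}
    (hT : IsPGroup p T) (hPT : P < T) : P < T ⊓ normalizer (P : Set G) := by
  have := hT.isNilpotent
  have h := Group.normalizerCondition_of_isNilpotent (G := T) (P.subgroupOf T)
    (lt_top_iff_ne_top.2 fun h => hPT.not_ge (subgroupOf_eq_top.1 h))
  refine lt_of_le_of_ne (le_inf hPT.le le_normalizer) fun heq => h.not_ge fun x hx => ?_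
  rw [mem_subgroupOf, heq]
  refine ⟨x.2, mem_normalizer_iff.2 fun y => ?_⟩
  rw [mem_normalizer_iff] at hx
  constructor
  · intro hy
    exact (hx ⟨y, hPT.le hy⟩).1 hy
  · intro hy
    have hyT : y ∈ T := by
      have := T.mul_mem (T.mul_mem (T.inv_mem x.2) (hPT.le hy)) x.2
      simpa [mul_assoc] using this
    exact (hx ⟨y, hyT⟩).2 hy

/-- Conjugation by `h` on `P` is also induced by an element of `X`. -/
def ConjInducedBy (X P : Subgroup G) (h : G) : Prop :=
  ∃ x ∈ X, ∀ q ∈ P, x * q * x⁻¹ = h * q * h⁻¹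

namespace ConjInducedBy

variable {X P Q : Subgroup G} {h k : G}

theorem mono (hPQ : P ≤ Q) (hQ : ConjInducedBy X Q h) : ConjInducedBy X P h := by
  obtain ⟨x, hx, hxq⟩ := hQ
  exact ⟨x, hx, fun q hq => hxq q (hPQ hq)⟩

theorem congr (hP : ConjInducedBy X P h) (hhk : ∀ q ∈ P, h * q * h⁻¹ = k * q * k⁻¹) :
    ConjInducedBy X P k := by
  obtain ⟨x, hx, hxq⟩ := hP
  exact ⟨x, hx, fun q hq => (hxq q hq).trans (hhk q hq)⟩

theorem mul (hQ : ConjInducedBy X Q k) (hP : ConjInducedBy X P h)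
    (hPQ : ∀ q ∈ P, h * q * h⁻¹ ∈ Q) : ConjInducedBy X P (k * h) := by
  obtain ⟨x, hx, hxq⟩ := hP
  obtain ⟨y, hy, hyq⟩ := hQ
  refine ⟨y * x, X.mul_mem hy hx, fun q hq => ?_⟩
  have h1 := hyq _ (hPQ q hq)
  rw [← hxq q hq] at h1
  calc y * x * q * (y * x)⁻¹ = y * (x * q * x⁻¹) * y⁻¹ := by group
    _ = k * (x * q * x⁻¹) * k⁻¹ := h1
    _ = k * (h * q * h⁻¹) * k⁻¹ := by rw [hxq q hq]
    _ = k * h * q * (k * h)⁻¹ := by group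

theorem inv (hP : ConjInducedBy X P h) (hQP : ∀ q ∈ Q, h⁻¹ * q * h ∈ P) :
    ConjInducedBy X Q h⁻¹ := by
  obtain ⟨x, hx, hxq⟩ := hP
  refine ⟨x⁻¹, X.inv_mem hx, fun q hq => ?_⟩
  have h1 := hxq _ (hQP q hq)
  have h2 : h * (h⁻¹ * q * h) * h⁻¹ = q := by group
  rw [h2] at h1
  calc x⁻¹ * q * x⁻¹⁻¹ = x⁻¹ * (x * (h⁻¹ * q * h) * x⁻¹) * x := by rw [h1, inv_inv]
    _ = h⁻¹ * q * h⁻¹⁻¹ := by group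

end ConjInducedBy

theorem inf_centralizer_conj_mem {N Q : Subgroup G} {n : G} (hn : n ∈ N ⊓ normalizer (Q : Set G))
    {c : G} (hc : c ∈ N ⊓ centralizer (Q : Set G)) :
    n * c * n⁻¹ ∈ N ⊓ centralizer (Q : Set G) := by
  refine ⟨N.mul_mem (N.mul_mem hn.1 hc.1) (N.inv_mem hn.1), fun q hq => ?_⟩
  have h1 := hc.2 _ ((mem_normalizer_iff''.1 hn.2 q).1 hq)
  calc q * (n * c * n⁻¹) = n * (n⁻¹ * q * n * c) * n⁻¹ := by group
    _ = n * (c * (n⁻¹ * q * n)) * n⁻¹ := by rw [h1]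
    _ = n * c * n⁻¹ * q := by group

theorem inf_centralizer_le_inf_normalizer (N Q : Subgroup G) :
    N ⊓ centralizer (Q : Set G) ≤ N ⊓ normalizer (Q : Set G) := by
  refine inf_le_inf_left _ fun c hc => ?_
  refine mem_normalizer_iff.2 fun q => ⟨fun hq => ?_, fun hq => ?_⟩
  · rwa [← hc q hq, mul_inv_cancel_right]
  · have h1 := hc _ hq
    have h2 : c * q * c⁻¹ * c = c * q := by group
    rw [h2] at h1
    rwa [← mul_left_cancel h1] at hq

theorem IsSylowIn.inf_centralizer [Finite G] [Fact p.Prime] {T H Q : Subgroup G}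
    (hY : IsSylowIn p (T ⊓ normalizer (Q : Set G)) (H ⊓ normalizer (Q : Set G)))
    (hTH : T ≤ H) :
    IsSylowIn p (T ⊓ centralizer (Q : Set G)) (H ⊓ centralizer (Q : Set G)) := by
  have h1 := hY.inf (inf_centralizer_le_inf_normalizer H Q)
    (fun n hn c hc => inf_centralizer_conj_mem hn hc)
  have h2 : T ⊓ normalizer (Q : Set G) ⊓ (H ⊓ centralizer (Q : Set G)) =
      T ⊓ centralizer (Q : Set G) := by
    ext x
    constructor
    · rintro ⟨⟨h1, h2⟩, h3, h4⟩
      exact ⟨h1, h4⟩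
    · rintro ⟨h1, h2⟩
      exact ⟨inf_centralizer_le_inf_normalizer T Q ⟨h1, h2⟩, hTH h1, h2⟩
  rwa [h2] at h1

theorem conj_mem_of_mem_normalizer {Q : Subgroup G} {n q : G} (hn : n ∈ normalizer (Q : Set G))
    (hq : q ∈ Q) : n * q * n⁻¹ ∈ Q :=
  (mem_normalizer_iff.1 hn q).1 hq

/-- The elements of `N_N(Q)` whose conjugation action on `Q` is induced by an element of `X`. -/
def conjInducedSubgroup (X N Q : Subgroup G) : Subgroup G where
  carrier := {n | n ∈ N ⊓ normalizer (Q : Set G) ∧ ConjInducedBy X Q n}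
  one_mem' := ⟨one_mem _, 1, one_mem _, fun _ _ => rfl⟩
  mul_mem' ha hb := ⟨mul_mem ha.1 hb.1,
    ha.2.mul hb.2 fun _ hq => conj_mem_of_mem_normalizer hb.1.2 hq⟩
  inv_mem' ha := ⟨inv_mem ha.1, ha.2.inv fun q hq => (mem_normalizer_iff''.1 ha.1.2 q).1 hq⟩

/-- Every subgroup of `T` is conjugate to a fully normalized one, in a way that extends to
normalizers of conjugates. -/
theorem IsSylowIn.exists_fullyNormalized [Finite G] [Fact p.Prime] {T H P : Subgroup G}
    (hT : IsSylowIn p T H) (hPT : P ≤ T) :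
    ∃ Q ≤ T, Nat.card Q = Nat.card P ∧
      IsSylowIn p (T ⊓ normalizer (Q : Set G)) (H ⊓ normalizer (Q : Set G)) ∧
      ∀ h ∈ H, (∀ x ∈ P, h * x * h⁻¹ ∈ T) → ∃ k ∈ H,
        (∀ x, x ∈ P.map (MulAut.conj h).toMonoidHom ↔ k * x * k⁻¹ ∈ Q) ∧
        ∀ x ∈ T ⊓ normalizer ((P.map (MulAut.conj h).toMonoidHom : Subgroup G) : Set G),
          k * x * k⁻¹ ∈ T := by
  obtain ⟨W, hW, hleW⟩ := exists_isSylowIn_ge (p := p)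
    (inf_le_inf_right (normalizer (P : Set G)) hT.le) (hT.isPGroup.to_le inf_le_left)
  obtain ⟨k, hk, hkW⟩ := hT.exists_conj_mem (hW.le.trans inf_le_left) hW.isPGroup
  set Q := P.map (MulAut.conj k).toMonoidHom with hQ
  have hmemQ (x : G) : x ∈ Q ↔ k⁻¹ * x * k ∈ P := mem_map_conj_iff
  have hnorm {R : Subgroup G} {j : G} (hj : ∀ x, x ∈ R ↔ j * x * j⁻¹ ∈ Q) {n : G}
      (hn : n ∈ normalizer (R : Set G)) : j * n * j⁻¹ ∈ normalizer (Q : Set G) := by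
    refine mem_normalizer_iff.2 fun q => ?_
    have h1 := mem_normalizer_iff.1 hn (j⁻¹ * q * j)
    rw [hj, hj] at h1
    convert h1 using 2 <;> group
  have hkP (x : G) : x ∈ P ↔ k * x * k⁻¹ ∈ Q := by
    rw [hmemQ]
    convert Iff.rfl using 2
    group
  have hPW : P ≤ W := (le_inf hPT le_normalizer).trans hleW
  have hQT : Q ≤ T := by
    rintro _ ⟨x, hx, rfl⟩
    exact hkW x (hPW hx)
  have hSyl : IsSylowIn p (T ⊓ normalizer (Q : Set G)) (H ⊓ normalizer (Q : Set G)) := by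
    refine ⟨inf_le_inf_right _ hT.le, hT.isPGroup.to_le inf_le_left, fun V hV hVp hle => ?_⟩
    have hWV (w : G) (hw : w ∈ W) : k * w * k⁻¹ ∈ T ⊓ normalizer (Q : Set G) :=
      ⟨hkW w hw, hnorm hkP (hW.le hw).2⟩
    have hVW : V.map (MulAut.conj k⁻¹).toMonoidHom = W := by
      refine hW.eq_of_le _ ?_ (hVp.map _) fun w hw => ?_
      · rintro _ ⟨v, hv, rfl⟩
        refine ⟨H.mul_mem (H.mul_mem (H.inv_mem hk) (hV hv).1) (H.inv_mem (H.inv_mem hk)), ?_⟩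
        refine mem_normalizer_iff.2 fun q => ?_
        have h1 := mem_normalizer_iff.1 (hV hv).2 (k * q * k⁻¹)
        rw [hkP, h1, hkP]
        convert Iff.rfl using 2
        simp [mul_assoc]
      · rw [mem_map_conj_iff, inv_inv]
        exact hle (hWV w hw)
    refine le_antisymm (fun v hv => ?_) hle
    have h1 : k⁻¹ * v * k ∈ W := by
      rw [← hVW, mem_map_conj_iff]
      simpa [mul_assoc] using hv
    simpa [mul_assoc] using hWV _ h1
  refine ⟨Q, hQT, card_map_conj P k, hSyl, fun h hh hhP => ?_⟩
  set R := P.map (MulAut.conj h).toMonoidHom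
  have hR (x : G) : x ∈ R ↔ (k * h⁻¹) * x * (k * h⁻¹)⁻¹ ∈ Q := by
    rw [hmemQ, mem_map_conj_iff]
    convert Iff.rfl using 2
    group
  have hkh : k * h⁻¹ ∈ H := H.mul_mem hk (H.inv_mem hh)
  obtain ⟨m, hm, hmV⟩ := hSyl.exists_conj_mem
    (W := (T ⊓ normalizer (R : Set G)).map (MulAut.conj (k * h⁻¹)).toMonoidHom)
    (by
      rintro _ ⟨x, hx, rfl⟩
      exact ⟨H.mul_mem (H.mul_mem hkh (hT.le hx.1)) (H.inv_mem hkh), hnorm hR hx.2⟩)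
    ((hT.isPGroup.to_le inf_le_left).map _)
  refine ⟨m * (k * h⁻¹), H.mul_mem hm.1 hkh, fun x => ?_, fun x hx => ?_⟩
  · rw [hR, mem_normalizer_iff.1 hm.2]
    convert Iff.rfl using 2
    group
  · have h1 := (hmV _ ⟨x, hx, rfl⟩).1
    convert h1 using 1
    simp [mul_assoc]

/-- A form of Alperin's fusion theorem: if the elements of order prime to `p` normalizing a
centric subgroup of `T` act on it as elements of `X ≥ T`, then `X` induces all `H`-fusion
in `T`. -/
theorem IsSylowIn.conjInducedBy [Finite G] [Fact p.Prime] {T H X : Subgroup G}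
    (hT : IsSylowIn p T H) (hTX : T ≤ X)
    (hX : ∀ Q ≤ T, T ⊓ centralizer (Q : Set G) ≤ Q →
      IsSylowIn p (T ⊓ centralizer (Q : Set G)) (H ⊓ centralizer (Q : Set G)) →
      ∀ n ∈ H ⊓ normalizer (Q : Set G), (orderOf n).Coprime p → ConjInducedBy X Q n)
    {P : Subgroup G} (hPT : P ≤ T) {h : G} (hh : h ∈ H) (hP : ∀ x ∈ P, h * x * h⁻¹ ∈ T) :
    ConjInducedBy X P h := by
  induction hm : Nat.card T - Nat.card P using Nat.strong_induction_on generalizing P h with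
  | _ m ih =>
  subst hm
  have ih' (R : Subgroup G) (hRT : R ≤ T) (hPR : Nat.card P < Nat.card R) (k : G) (hk : k ∈ H)
      (hkR : ∀ x ∈ R, k * x * k⁻¹ ∈ T) : ConjInducedBy X R k := by
    have := card_le_of_le hRT
    exact ih _ (by omega) hRT hk hkR rfl
  have normalizer_case (Q : Subgroup G) (hQT : Q ≤ T) (hcard : Nat.card Q = Nat.card P)
      (hQ : IsSylowIn p (T ⊓ normalizer (Q : Set G)) (H ⊓ normalizer (Q : Set G)))
      (n : G) (hn : n ∈ H ⊓ normalizer (Q : Set G)) : ConjInducedBy X Q n := by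
    have hC := hQ.inf_centralizer hT.le
    by_cases hcen : T ⊓ centralizer (Q : Set G) ≤ Q
    · refine (le_of_forall_orderOf_coprime_mem (M := conjInducedSubgroup X H Q) hQ
        (fun y hy => ⟨hQ.le hy, y, hTX hy.1, fun _ _ => rfl⟩)
        (fun y hy hyp => ⟨hy, hX Q hQT hcen hC y hy hyp⟩) hn).2
    · obtain ⟨c, hc, hcn⟩ := hC.exists_conj_mem
        (W := (T ⊓ centralizer (Q : Set G)).map (MulAut.conj n).toMonoidHom)
        (by
          rintro _ ⟨x, hx, rfl⟩
          exact inf_centralizer_conj_mem hn (hC.le hx))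
        (hC.isPGroup.map _)
      have hcn1 (q : G) (hq : q ∈ Q) : c * n * q * (c * n)⁻¹ = n * q * n⁻¹ := by
        have := hc.2 _ (conj_mem_of_mem_normalizer hn.2 hq)
        calc c * n * q * (c * n)⁻¹ = c * (n * q * n⁻¹) * c⁻¹ := by group
          _ = n * q * n⁻¹ := by rw [← this]; group
      have hlt : Q < Q ⊔ T ⊓ centralizer (Q : Set G) := left_lt_sup.2 hcen
      have hle : Q ⊔ T ⊓ centralizer (Q : Set G) ≤
          T.comap (MulAut.conj (c * n)).toMonoidHom := by
        refine sup_le (fun q hq => ?_) (fun x hx => ?_)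
        · change c * n * q * (c * n)⁻¹ ∈ T
          rw [hcn1 q hq]
          exact hQT (conj_mem_of_mem_normalizer hn.2 hq)
        · have := (hcn _ ⟨x, hx, rfl⟩).1
          rw [mem_comap]
          convert this using 1
          simp [mul_assoc]
      refine ((ih' (Q ⊔ T ⊓ centralizer (Q : Set G)) (sup_le hQT inf_le_left) ?_ (c * n)
        (H.mul_mem hc.1 hn.1) (fun x hx => hle hx)).mono hlt.le).congr hcn1
      rw [← hcard]
      exact lt_of_not_ge fun hge => hlt.ne (eq_of_le_of_card_ge hlt.le hge)
  have hlt_of_lt {A B : Subgroup G} (hAB : A < B) : Nat.card A < Nat.card B :=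
    lt_of_not_ge fun hge => hAB.ne (eq_of_le_of_card_ge hAB.le hge)
  obtain ⟨Q, hQT, hcard, hQ, hconj⟩ := hT.exists_fullyNormalized hPT
  by_cases hPeq : P = T
  · have hQP : Q = P := eq_of_le_of_card_ge (hPeq ▸ hQT) hcard.ge
    refine normalizer_case P hPT rfl (hQP ▸ hQ) h
      ⟨hh, mem_normalizer_iff_map_conj_eq.2 ?_⟩
    refine eq_of_le_of_card_ge ?_ (card_map_conj P h).ge
    rintro _ ⟨x, hx, rfl⟩
    rw [hPeq]
    exact hP x hx
  · have key (j : G) (hj : j ∈ H) (hjP : ∀ x ∈ P, j * x * j⁻¹ ∈ T) : ∃ k ∈ H,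
        (∀ x, x ∈ P.map (MulAut.conj j).toMonoidHom ↔ k * x * k⁻¹ ∈ Q) ∧
        ConjInducedBy X (P.map (MulAut.conj j).toMonoidHom) k := by
      obtain ⟨k, hk, hkQ, hkT⟩ := hconj j hj hjP
      refine ⟨k, hk, hkQ, ?_⟩
      have hle : P.map (MulAut.conj j).toMonoidHom ≤ T := by
        rintro _ ⟨x, hx, rfl⟩
        exact hjP x hx
      have hlt : P.map (MulAut.conj j).toMonoidHom < T := by
        refine lt_of_le_of_ne hle fun heq => hPeq (eq_of_le_of_card_ge hPT ?_)
        rw [← heq, card_map_conj]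
      have hlt' := hT.isPGroup.lt_inf_normalizer hlt
      refine (ih' _ inf_le_left ?_ k hk hkT).mono hlt'.le
      rw [← card_map_conj P j]
      exact hlt_of_lt hlt'
    obtain ⟨a, ha, haQ, haX⟩ := key 1 (one_mem _) (by simpa using fun x hx => hPT hx)
    obtain ⟨b, hb, hbQ, hbX⟩ := key h hh hP
    have hP1 : P.map (MulAut.conj (1 : G)).toMonoidHom = P := by
      ext x; simp
    rw [hP1] at haQ haX
    have hbh (q : G) : q ∈ P ↔ b * (h * q * h⁻¹) * b⁻¹ ∈ Q := by
      rw [← hbQ, mem_map_conj_iff]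
      simp [mul_assoc]
    have hn : b * h * a⁻¹ ∈ H ⊓ normalizer (Q : Set G) := by
      refine ⟨H.mul_mem (H.mul_mem hb hh) (H.inv_mem ha), mem_normalizer_iff.2 fun q => ?_⟩
      have h1 := haQ (a⁻¹ * q * a)
      rw [hbh] at h1
      refine Iff.trans ?_ (h1.symm.trans ?_)
      · convert Iff.rfl using 2
        group
      · convert Iff.rfl using 2
        group
    have hn1 := (normalizer_case Q hQT hcard hQ _ hn).mul haX fun q hq => (haQ q).1 hq
    have hb1 : ConjInducedBy X Q b⁻¹ := hbX.inv fun q hq => by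
      rw [hbQ]
      simpa [mul_assoc] using hq
    have := hb1.mul hn1 fun q hq => by
      have := conj_mem_of_mem_normalizer hn.2 ((haQ q).1 hq)
      convert this using 1
      group
    refine this.congr fun q _ => ?_
    group

theorem commute_of_commute_mul_of_coprime {Γ : Type*} [Group Γ] [Fact p.Prime] {V : Subgroup Γ}
    (hV : IsPGroup p V) (hVV : ∀ a ∈ V, ∀ b ∈ V, Commute a b) {g h d : Γ}
    (hgV : ∀ a ∈ V, Commute g a) (hdV : ∀ a ∈ V, Commute d a)
    (hgh : g * h * g⁻¹ * h⁻¹ ∈ V) (hdh : d * h * d⁻¹ * h⁻¹ ∈ V)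
    (hhV : ∀ a ∈ V, h⁻¹ * a * h ∈ V) (hcomm : Commute g (h * d))
    (hcop : (orderOf h).Coprime p) : Commute g h := by
  obtain ⟨a, ha⟩ : ∃ a, a = g * h * g⁻¹ * h⁻¹ := ⟨_, rfl⟩
  obtain ⟨b, hb⟩ : ∃ b, b = d * h * d⁻¹ * h⁻¹ := ⟨_, rfl⟩
  obtain ⟨e, he⟩ : ∃ e, e = h⁻¹ * a⁻¹ * h := ⟨_, rfl⟩
  rw [← ha] at hgh
  rw [← hb] at hdh
  have heV : e ∈ V := he ▸ hhV _ (V.inv_mem hgh)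
  have hg : g * h * g⁻¹ = a * h := by rw [ha]; group
  have hd : d * h * d⁻¹ = b * h := by rw [hb]; group
  have hgd : g * d = e * d * g := by
    calc g * d = g * h⁻¹ * g⁻¹ * (g * (h * d)) := by group
      _ = g * h⁻¹ * g⁻¹ * (h * d * g) := by rw [hcomm.eq]
      _ = (h⁻¹ * (h * g * h⁻¹ * g⁻¹) * h) * d * g := by group
      _ = e * d * g := by rw [he, ha]; group
  have h1 : (g * d) * h * (g * d)⁻¹ = b * a * h := by
    calc (g * d) * h * (g * d)⁻¹ = g * (d * h * d⁻¹) * g⁻¹ := by group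
      _ = (g * b) * h * g⁻¹ := by rw [hd]; group
      _ = b * (g * h * g⁻¹) := by rw [(hgV b hdh).eq]; group
      _ = b * a * h := by rw [hg]; group
  have h2 : (g * d) * h * (g * d)⁻¹ = b * a * (e * h * e⁻¹) := by
    calc (g * d) * h * (g * d)⁻¹ = e * (d * (g * h * g⁻¹) * d⁻¹) * e⁻¹ := by rw [hgd]; group
      _ = e * ((d * a) * h * d⁻¹) * e⁻¹ := by rw [hg]; group
      _ = e * (a * (d * h * d⁻¹)) * e⁻¹ := by rw [(hdV a hgh).eq]; group
      _ = e * (a * b) * h * e⁻¹ := by rw [hd]; group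
      _ = b * a * (e * h * e⁻¹) := by
        rw [(hVV a hgh b hdh).eq, (hVV e heV _ (V.mul_mem hdh hgh)).eq]; group
  have heh : e * h = h * e := by
    have := mul_left_cancel (h1.symm.trans h2)
    rw [eq_mul_inv_iff_mul_eq] at this
    exact this.symm
  have hae : a = e⁻¹ := by
    have : h * e = a⁻¹ * h := by rw [he]; group
    rw [← heh] at this
    rw [mul_right_cancel this, inv_inv]
  have hah : Commute a h := hae ▸ Commute.inv_left heh
  have hn : a ^ orderOf h = 1 := by
    have h3 : (a * h) ^ orderOf h = 1 := by
      rw [← hg, conj_pow, pow_orderOf_eq_one, mul_one, mul_inv_cancel]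
    rwa [hah.mul_pow, pow_orderOf_eq_one, mul_one] at h3
  have ha1 : a = 1 := by
    obtain ⟨k, hk⟩ := IsPGroup.iff_orderOf.1 hV ⟨a, hgh⟩
    rw [orderOf_mk] at hk
    rw [← orderOf_eq_one_iff]
    refine Nat.eq_one_of_dvd_coprimes (a := orderOf h) (b := p ^ k) ?_ ?_ hk.dvd
    · exact hcop.pow_right k
    · exact orderOf_dvd_of_pow_eq_one hn
  rw [ha1, one_mul] at hg
  exact mul_inv_eq_iff_eq_mul.1 hg

/-- Burnside's normal `p`-complement theorem for a central Sylow subgroup `Y` of `C`. -/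
theorem IsSylowIn.exists_complement [Finite G] [Fact p.Prime] {Y C : Subgroup G}
    (hY : IsSylowIn p Y C) (hYC : ∀ y ∈ Y, ∀ c ∈ C, Commute y c) :
    ∃ K ≤ C, ¬ p ∣ Nat.card K ∧ (∀ c ∈ C, ∃ y ∈ Y, ∃ k ∈ K, y * k = c) ∧
      ∀ c ∈ C, (orderOf c).Coprime p → c ∈ K := by
  have hP : normalizer (hY.toSylow : Set C) ≤ centralizer (hY.toSylow : Set C) :=
    fun c _ y hy => Subtype.ext (hYC y hy c c.2)
  set f := MonoidHom.transferSylow hY.toSylow hP with hf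
  have hcompl := MonoidHom.ker_transferSylow_isComplement' hY.toSylow hP
  refine ⟨f.ker.map C.subtype, map_subtype_le _, ?_, fun c hc => ?_, fun c hc hcp => ?_⟩
  · rw [Nat.card_congr (f.ker.equivMapOfInjective _ C.subtype_injective).symm.toEquiv]
    exact MonoidHom.not_dvd_card_ker_transferSylow hY.toSylow hP
  · obtain ⟨⟨y, k⟩, hyk⟩ := hcompl.symm.2 ⟨c, hc⟩
    exact ⟨y.1, y.2, k.1, ⟨k.1, k.2, rfl⟩, congrArg Subtype.val hyk⟩
  · refine ⟨⟨c, hc⟩, ?_, rfl⟩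
    obtain ⟨k, hk⟩ := IsPGroup.iff_orderOf.1 hY.toSylow.isPGroup' (f ⟨c, hc⟩)
    rw [SetLike.mem_coe, MonoidHom.mem_ker, ← orderOf_eq_one_iff]
    refine Nat.eq_one_of_dvd_coprimes (a := orderOf c) (b := p ^ k) (hcp.pow_right k) ?_ hk.dvd
    rw [← orderOf_mk c hc]
    exact orderOf_map_dvd f _

/-- A `p`-group `A` acting on a coset `K * n` of a `p'`-group by conjugation has a fixed point. -/
theorem exists_mul_commute_of_isPGroup [Fact p.Prime] {A K : Subgroup G}
    (hA : IsPGroup p A) (hK : ¬ p ∣ Nat.card K) (hAK : ∀ r ∈ A, ∀ k ∈ K, r * k * r⁻¹ ∈ K) {n : G}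
    (hn : ∀ r ∈ A, r * n * r⁻¹ * n⁻¹ ∈ K) : ∃ k ∈ K, ∀ r ∈ A, Commute r (k * n) := by
  let _ : MulAction A K :=
    { smul r k := ⟨r * (k * n) * r⁻¹ * n⁻¹, by
        have := K.mul_mem (hAK r r.2 k k.2) (hn r r.2)
        convert this using 1
        simp [mul_assoc]⟩
      one_smul k := Subtype.ext (by
        change 1 * (k * n) * 1⁻¹ * n⁻¹ = (k : G)
        group)
      mul_smul r s k := Subtype.ext (by
        change (r * s : G) * (k * n) * (r * s : G)⁻¹ * n⁻¹ =
          r * (s * (k * n) * (s : G)⁻¹ * n⁻¹ * n) * (r : G)⁻¹ * n⁻¹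
        group) }
  obtain ⟨k, hk⟩ := hA.nonempty_fixed_point_of_prime_not_dvd_card K hK
  refine ⟨k, k.2, fun r hr => ?_⟩
  have h1 : r * (k * n) * r⁻¹ * n⁻¹ = k := congrArg Subtype.val (hk ⟨r, hr⟩)
  rw [mul_inv_eq_iff_eq_mul, mul_inv_eq_iff_eq_mul] at h1
  exact h1

theorem conjInducedBy_centralizer_of_centric [Finite G] [Fact p.Prime] {T H A Q : Subgroup G}
    [hH : H.Normal] (hcen : T ⊓ centralizer (Q : Set G) ≤ Q)
    (hC : IsSylowIn p (T ⊓ centralizer (Q : Set G)) (H ⊓ centralizer (Q : Set G)))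
    {s : Set G} (hs : closure s = A) (hA : IsPGroup p A) (hAQ : A ≤ centralizer (Q : Set G))
    {n : G} (hn : n ∈ H ⊓ normalizer (Q : Set G)) (hnp : (orderOf n).Coprime p)
    (hsn : ∀ g ∈ s, ConjInducedBy (centralizer {g}) Q n) :
    ConjInducedBy (centralizer s) Q n := by
  obtain ⟨K, hKC, hKp, hYK, hKmem⟩ := hC.exists_complement
    (fun y hy c hc => hc.2 y (hcen hy))
  set C := H ⊓ centralizer (Q : Set G) with hCdef
  set M := normalizer (Q : Set G) with hM
  have hcent_le : centralizer (Q : Set G) ≤ M := by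
    simpa using inf_centralizer_le_inf_normalizer ⊤ Q
  have hCM : C ≤ M := inf_le_right.trans hcent_le
  have hCconj (m : G) (hm : m ∈ M) (c : G) (hc : c ∈ C) : m * c * m⁻¹ ∈ C :=
    ⟨hH.conj_mem c hc.1 m, (inf_centralizer_conj_mem (N := ⊤) ⟨mem_top m, hm⟩
      ⟨mem_top c, hc.2⟩).2⟩
  have hKconj (m : G) (hm : m ∈ M) (k : G) (hk : k ∈ K) : m * k * m⁻¹ ∈ K := by
    refine hKmem _ (hCconj m hm k (hKC hk)) ?_
    have h1 : orderOf (m * k * m⁻¹) = orderOf k :=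
      orderOf_injective (MulAut.conj m).toMonoidHom (MulAut.conj m).injective k
    rw [h1]
    exact Nat.Coprime.coprime_dvd_left (orderOf_dvd_natCard _ hk)
      ((Nat.Prime.coprime_iff_not_dvd Fact.out).2 hKp).symm
  have : (K.subgroupOf M).Normal := ⟨fun k hk m => hKconj m m.2 k hk⟩
  let π := QuotientGroup.mk' (K.subgroupOf M)
  let V := (C.subgroupOf M).map π
  have hYC : T ⊓ centralizer (Q : Set G) ≤ C := hC.le
  have hV (v : M ⧸ K.subgroupOf M) (hv : v ∈ V) :
      ∃ y : M, (y : G) ∈ T ⊓ centralizer (Q : Set G) ∧ π y = v := by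
    obtain ⟨c, hc, rfl⟩ := hv
    obtain ⟨y, hy, k, hk, hyk⟩ := hYK c hc
    refine ⟨⟨y, hCM (hYC hy)⟩, hy, ?_⟩
    refine QuotientGroup.eq.2 ?_
    rw [mem_subgroupOf]
    convert hk
    simp [← hyk]
  have hcommV {d : M} (hd : (d : G) ∈ centralizer (Q : Set G)) (v : M ⧸ K.subgroupOf M)
      (hv : v ∈ V) : Commute (π d) v := by
    obtain ⟨y, hy, rfl⟩ := hV v hv
    have : Commute d y := Subtype.ext (hd y (hcen hy)).symm
    exact this.map π
  have hVp : IsPGroup p V := by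
    rintro ⟨v, hv⟩
    obtain ⟨y, hy, rfl⟩ := hV v hv
    obtain ⟨k, hk⟩ := hC.isPGroup ⟨y, hy⟩
    refine ⟨k, Subtype.ext ?_⟩
    have h1 : y ^ p ^ k = 1 := Subtype.ext (by simpa using Subtype.ext_iff.1 hk)
    change π y ^ p ^ k = 1
    rw [← map_pow, h1, map_one]
  have hnV {d : M} (hd : (d : G) ∈ centralizer (Q : Set G)) :
      π d * π ⟨n, hn.2⟩ * (π d)⁻¹ * (π ⟨n, hn.2⟩)⁻¹ ∈ V := by
    refine ⟨d * ⟨n, hn.2⟩ * d⁻¹ * ⟨n, hn.2⟩⁻¹, ?_, by simp⟩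
    refine ⟨H.mul_mem (hH.conj_mem n hn.1 d) (H.inv_mem hn.1), ?_⟩
    have h1 := (inf_centralizer_conj_mem (N := ⊤) (n := n) ⟨mem_top n, hn.2⟩
      ⟨mem_top (d : G)⁻¹, Subgroup.inv_mem _ hd⟩).2
    have h2 := mul_mem hd h1
    rw [SetLike.mem_coe]
    convert h2 using 1
    simp [mul_assoc]
  have hAM (r : G) (hr : r ∈ A) : r ∈ M := hcent_le (hAQ hr)
  have hcomm (g : G) (hg : g ∈ s) (hgM : g ∈ M) : Commute (π ⟨g, hgM⟩) (π ⟨n, hn.2⟩) := by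
    have hgA : g ∈ A := hs ▸ subset_closure hg
    obtain ⟨x, hx, hxq⟩ := hsn g hg
    have hd : n⁻¹ * x ∈ centralizer (Q : Set G) := by
      intro q hq
      have h1 : x * q = n * q * n⁻¹ * x := by rw [← hxq q hq]; group
      calc q * (n⁻¹ * x) = n⁻¹ * (n * q * n⁻¹ * x) := by group
        _ = n⁻¹ * x * q := by rw [← h1]; group
    refine commute_of_commute_mul_of_coprime (d := π ⟨n⁻¹ * x, hcent_le hd⟩) hVp
      (fun a ha b hb => ?_) (hcommV (hAQ hgA)) (hcommV hd) (hnV (hAQ hgA)) (hnV hd)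
      (fun a ha => ?_) ?_ ?_
    · obtain ⟨y, hy, rfl⟩ := hV a ha
      exact hcommV hy.2 b hb
    · obtain ⟨c, hc, rfl⟩ := ha
      refine ⟨⟨n, hn.2⟩⁻¹ * c * ⟨n, hn.2⟩, ?_, by simp⟩
      have h1 := hCconj n⁻¹ (inv_mem hn.2) c hc
      rw [inv_inv] at h1
      exact h1
    · rw [← map_mul]
      refine Commute.map (Subtype.ext ?_) π
      have h1 : n * (n⁻¹ * x) = x := by group
      change g * (n * (n⁻¹ * x)) = n * (n⁻¹ * x) * g
      rw [h1]
      exact hx g rfl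
    · refine Nat.Coprime.coprime_dvd_left (orderOf_map_dvd π _) ?_
      rwa [orderOf_mk]
  have hAn (r : G) (hr : r ∈ A) : r * n * r⁻¹ * n⁻¹ ∈ K := by
    have hle : A ≤ ((centralizer {π ⟨n, hn.2⟩}).comap π).map M.subtype := by
      rw [← hs, closure_le]
      intro g hg
      have hgM := hAM g (hs ▸ subset_closure hg)
      refine ⟨⟨g, hgM⟩, ?_, rfl⟩
      rintro _ rfl
      exact (hcomm g hg hgM).eq.symm
    obtain ⟨r, hrn, rfl⟩ := hle hr
    have h1 : π (r * ⟨n, hn.2⟩ * r⁻¹ * ⟨n, hn.2⟩⁻¹) = 1 := by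
      have h2 := hrn _ rfl
      simp only [map_mul, map_inv, ← h2]
      group
    exact (QuotientGroup.eq_one_iff (N := K.subgroupOf M) _).1 h1
  obtain ⟨k, hk, hkn⟩ := exists_mul_commute_of_isPGroup hA hKp
    (fun r hr => hKconj r (hAM r hr)) hAn
  refine ⟨k * n, fun g hg => hkn g (hs ▸ subset_closure hg), fun q hq => ?_⟩
  have h1 := (hKC hk).2 _ (conj_mem_of_mem_normalizer hn.2 hq)
  calc k * n * q * (k * n)⁻¹ = k * (n * q * n⁻¹) * k⁻¹ := by group
    _ = n * q * n⁻¹ := by rw [← h1]; group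

end Subgroup

/-- Every morphism of `E = F_T(H)` extends to one fixing `C_S(E)` pointwise; in
particular, `C_S(E)` is the largest subgroup `X` of `S ∩ C_G(T)` such that
`F_T(H) ⊆ C_{F_S(G)}(X)`. -/
theorem fusionCent_pointwise_extension (p : ℕ) [Fact p.Prime] (G : Type*) [Group G]
    [Finite G] (H : Subgroup G) [H.Normal] (S : Sylow p G)
    (T : Subgroup G) (hT : T = (S : Subgroup G) ⊓ H) :
    (∀ P : Subgroup G, P ≤ T → ∀ h ∈ H, (∀ x ∈ P, h * x * h⁻¹ ∈ T) →
        ∃ x : G, (∀ c ∈ fusionCent (S : Subgroup G) H, x * c * x⁻¹ = c) ∧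
          ∀ q ∈ P, x * q * x⁻¹ = h * q * h⁻¹) ∧
      (∀ X : Subgroup G, X ≤ (S : Subgroup G) ⊓ Subgroup.centralizer (T : Set G) →
        (∀ P : Subgroup G, P ≤ T → ∀ h ∈ H, (∀ x ∈ P, h * x * h⁻¹ ∈ T) →
          ∃ x ∈ Subgroup.centralizer (X : Set G), ∀ q ∈ P, x * q * x⁻¹ = h * q * h⁻¹) →
        (X : Set G) ⊆ fusionCent (S : Subgroup G) H) := by
  subst hT
  have hT : Subgroup.IsSylowIn p ((S : Subgroup G) ⊓ H) H :=
    Subgroup.IsSylowIn.inf (N := ⊤) ⟨le_top, S.isPGroup', fun _ _ hW => S.is_maximal' hW⟩ le_top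
      fun n _ k hk => Subgroup.Normal.conj_mem inferInstance k hk n
  refine ⟨fun P hP h hh hPh => ?_, fun X hX hXE g hg => ?_⟩
  · have hS : Subgroup.closure (fusionCent (S : Subgroup G) H) ≤ S :=
      (Subgroup.closure_le _).2 fun g hg => hg.1
    have hcent : Subgroup.closure (fusionCent (S : Subgroup G) H) ≤
        Subgroup.centralizer (((S : Subgroup G) ⊓ H : Subgroup G) : Set G) :=
      (Subgroup.closure_le _).2 fun g hg => hg.2.1
    obtain ⟨x, hx, hxq⟩ := hT.conjInducedBy
      (X := Subgroup.centralizer (fusionCent (S : Subgroup G) H))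
      (fun t ht g hg => (hg.2.1 t ht).symm)
      (fun Q hQ hcen hC n hn hnp =>
        Subgroup.conjInducedBy_centralizer_of_centric hcen hC rfl (S.isPGroup'.to_le hS)
          (hcent.trans (Subgroup.centralizer_le hQ)) hn hnp fun g hg =>
            hg.2.2 Q hQ n hn.1 fun q hq => hQ (Subgroup.conj_mem_of_mem_normalizer hn.2 hq))
      hP hh hPh
    exact ⟨x, fun c hc => by rw [← hx c hc, mul_inv_cancel_right], hxq⟩
  · refine ⟨(hX hg).1, (hX hg).2, fun P hP h hh hPh => ?_⟩
    obtain ⟨x, hx, hxq⟩ := hXE P hP h hh hPh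
    exact ⟨x, Subgroup.centralizer_le (Set.singleton_subset_iff.2 hg) hx, hxq⟩
end
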